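/- arXiv:2309.06338 — 3 statements merged into one kernel-verified Lean document; each statement's English description precedes it below -/
import Mathlib

section
/- Let T be a finite tree whose diameter is even and positive. Then the girth of the eccentric graph E(T) equals 3. (Concretely, the two endpoints and the midpoint of a diametrical path form a triangle in E(T), and this is a shortest cycle.) -/
open SimpleGraph

/-- The eccentricity of a vertex `v`: the max distance from `v` to any vertex. -/
noncomputable def ecc {V : Type*} [Fintype V] (G : SimpleGraph V) (v : V) : ℕ :=
  Finset.univ.sup fun u => G.dist v u

/-- `u` is eccentric to `v` in `G` if `d(v,u) = e(v)`. -/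
def IsEccentric {V : Type*} [Fintype V] (G : SimpleGraph V) (v u : V) : Prop :=
  G.dist v u = ecc G v

/-- The eccentric graph of `G`: distinct `u, v` adjacent iff one is eccentric to the other. -/
noncomputable def eccGraph {V : Type*} [Fintype V] (G : SimpleGraph V) : SimpleGraph V :=
  SimpleGraph.fromRel fun u v => IsEccentric G u v

/-- The diameter of `G`: the maximum eccentricity. -/
noncomputable def gdiam {V : Type*} [Fintype V] (G : SimpleGraph V) : ℕ :=
  Finset.univ.sup fun v => ecc G v

namespace SimpleGraph

variable {V : Type*} {T : SimpleGraph V}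

lemma IsTree.length_eq_dist (hT : T.IsTree) {u v : V} {p : T.Walk u v} (hp : p.IsPath) :
    p.length = T.dist u v := by
  obtain ⟨q, hq, hlen⟩ := hT.connected.exists_path_of_dist u v
  rw [← hlen, (hT.existsUnique_path u v).unique hp hq]

/-- In a tree, every vertex `x` is on the far side of an interior vertex `c` of a path,
as seen from at least one endpoint of that path. -/
lemma IsTree.dist_eq_add_or_dist_eq_add (hT : T.IsTree) {a b c : V}
    (h : T.dist a b = T.dist a c + T.dist c b) (x : V) :
    T.dist a x = T.dist a c + T.dist c x ∨ T.dist b x = T.dist b c + T.dist c x := by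
  obtain ⟨p, hp, hpl⟩ := hT.connected.exists_path_of_dist a c
  obtain ⟨q, hq, hql⟩ := hT.connected.exists_path_of_dist c b
  obtain ⟨w, hw, hwl⟩ := hT.connected.exists_path_of_dist c x
  have hpq : (p.append q).IsPath := Walk.isPath_of_length_eq_dist _ (by simp [h, hpl, hql])
  by_cases hpw : (p.append w).IsPath
  · left
    rw [← hT.length_eq_dist hpw, Walk.length_append, hpl, hwl]
  · right
    have hqw : (q.reverse.append w).IsPath := by
      have hqr := hq.reverse
      rw [hT.isAcyclic.isPath_iff_isChain] at *
      simp only [Walk.edges_append, Walk.edges_reverse, List.isChain_append,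
        List.getLast?_reverse, Option.mem_def] at *
      refine ⟨hqr, hw, fun e he f hf hef => hpw ⟨hp, hw, fun e' he' f' hf' hef' => ?_⟩⟩
      have hff : f = f' := Option.some.inj (hf.symm.trans hf')
      exact hpq.2.2 e' he' e he (by rw [hef', hef, hff])
    rw [← hT.length_eq_dist hqw, Walk.length_append, Walk.length_reverse, hql, hwl,
      T.dist_comm (u := c)]

lemma Connected.exists_dist_eq_and_dist_eq (hG : T.Connected) {a b : V} {m n : ℕ}
    (h : T.dist a b = m + n) : ∃ c, T.dist a c = m ∧ T.dist c b = n := by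
  obtain ⟨p, hp⟩ := hG.exists_walk_length_eq_dist a b
  have h₁ := dist_le (p.take m)
  have h₂ := dist_le (p.drop m)
  have h₃ := hG.dist_triangle (u := a) (v := p.getVert m) (w := b)
  rw [Walk.take_length] at h₁
  rw [Walk.drop_length] at h₂
  exact ⟨p.getVert m, by omega, by omega⟩

lemma egirth_eq_three_of_adj {a b c : V} (hab : T.Adj a b) (hbc : T.Adj b c) (hca : T.Adj c a) :
    T.egirth = 3 := by
  refine le_antisymm ?_ three_le_egirth
  have hcyc : (Walk.cons hab (.cons hbc (.cons hca .nil))).IsCycle := by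
    simp [Walk.cons_isCycle_iff, hab.ne, hab.ne', hbc.ne, hca.ne, hca.ne']
  simpa using egirth_le_length hcyc

end SimpleGraph

section Eccentricity

variable {V : Type*} [Fintype V] (G : SimpleGraph V)

lemma dist_le_ecc (u v : V) : G.dist u v ≤ ecc G u :=
  Finset.le_sup (f := fun w => G.dist u w) (Finset.mem_univ v)

lemma ecc_le_gdiam (v : V) : ecc G v ≤ gdiam G :=
  Finset.le_sup (f := fun w => ecc G w) (Finset.mem_univ v)

lemma exists_dist_eq_gdiam [Nonempty V] : ∃ u v, G.dist u v = gdiam G := by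
  obtain ⟨u, -, hu⟩ := Finset.exists_mem_eq_sup Finset.univ Finset.univ_nonempty
    fun v => ecc G v
  obtain ⟨v, -, hv⟩ := Finset.exists_mem_eq_sup Finset.univ Finset.univ_nonempty
    fun v => G.dist u v
  exact ⟨u, v, hv.symm.trans hu.symm⟩

end Eccentricity

/-- If a finite tree has even positive diameter, the girth of its eccentric graph is 3. -/
theorem stmt_1 {V : Type*} [Fintype V] (T : SimpleGraph V) (hT : T.IsTree)
    (heven : Even (gdiam T)) (hpos : 0 < gdiam T) :
    (eccGraph T).egirth = 3 := by
  have := hT.connected.nonempty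
  obtain ⟨r, hr⟩ := heven
  obtain ⟨a, b, hab⟩ := exists_dist_eq_gdiam T
  obtain ⟨c, hac, hcb⟩ := hT.connected.exists_dist_eq_and_dist_eq (hab.trans hr)
  have hca : T.dist c a = r := by rw [T.dist_comm, hac]
  have hbc : T.dist b c = r := by rw [T.dist_comm, hcb]
  have hle (u v : V) : T.dist u v ≤ gdiam T := (dist_le_ecc T u v).trans (ecc_le_gdiam T u)
  have hecc : ecc T c = r := by
    refine le_antisymm (Finset.sup_le fun x _ => ?_) (hca ▸ dist_le_ecc T c a)
    have := hle a x
    have := hle b x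
    have := hT.dist_eq_add_or_dist_eq_add (a := a) (b := b) (c := c) (by omega) x
    omega
  have hne {u v : V} (h : 0 < T.dist u v) : u ≠ v := by
    rintro rfl
    simp at h
  have heab : IsEccentric T a b :=
    le_antisymm (dist_le_ecc T a b) (hab ▸ ecc_le_gdiam T a)
  exact egirth_eq_three_of_adj (a := a) (b := b) (c := c)
    ⟨hne (by omega), .inl heab⟩ ⟨hne (by omega), .inr (hcb.trans hecc.symm)⟩
    ⟨hne (by omega), .inl (hca.trans hecc.symm)⟩
end

section
/- Let T be a finite tree such that the eccentric graph E(T) has girth 3 and E(T) contains no 4-cycle. Define G_1 = T □ P_2 and G_{j+1} = G_j □ P_2 for j ≥ 1, where P_2 is the path graph on 2 vertices. Then for every j ≥ 1, the girth of the eccentric graph E(G_j) equals 6. -/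
open SimpleGraph

/-- Vertex type of the iterated box product with `P_2`. -/
def iterV (V : Type*) : ℕ → Type _
  | 0 => V
  | j + 1 => iterV V j × Fin 2

instance iterV.fintype (V : Type*) [Fintype V] : ∀ j, Fintype (iterV V j)
  | 0 => inferInstanceAs (Fintype V)
  | j + 1 => @instFintypeProd _ _ (iterV.fintype V j) inferInstance

/-- The iterated box product `G_j`, with `G_0 = G` and `G_{j+1} = G_j □ P_2`. -/
noncomputable def iterG {V : Type*} (G : SimpleGraph V) : ∀ j, SimpleGraph (iterV V j)
  | 0 => G
  | j + 1 => (iterG G j).boxProd (pathGraph 2)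

lemma isEccentric_iff {V : Type*} [Fintype V] {G : SimpleGraph V} {v u : V} :
    IsEccentric G v u ↔ ∀ w, G.dist v w ≤ G.dist v u := by
  have hle (w : V) : G.dist v w ≤ ecc G v :=
    Finset.le_sup (f := fun u => G.dist v u) (Finset.mem_univ w)
  refine ⟨fun h w => (hle w).trans_eq h.symm, fun h => le_antisymm (hle u) ?_⟩
  exact Finset.sup_le fun w _ => h w

lemma IsEccentric.ne {V : Type*} [Fintype V] [Nontrivial V] {G : SimpleGraph V}
    (hG : G.Connected) {v u : V} (h : IsEccentric G v u) : v ≠ u := by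
  rintro rfl
  obtain ⟨w, hw⟩ := exists_ne v
  have hle := isEccentric_iff.1 h w
  have hpos := hG.pos_dist_of_ne hw.symm
  rw [SimpleGraph.dist_self] at hle
  omega

lemma dist_boxProd_of_connected {V W : Type*} {G : SimpleGraph V} {H : SimpleGraph W}
    (hG : G.Connected) (hH : H.Connected) (x y : V × W) :
    (G □ H).dist x y = G.dist x.1 y.1 + H.dist x.2 y.2 := by
  simp only [SimpleGraph.dist, edist_boxProd]
  exact ENat.toNat_add (edist_ne_top_iff_reachable.2 (hG x.1 y.1))
    (edist_ne_top_iff_reachable.2 (hH x.2 y.2))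

lemma dist_pathGraph_two (i k : Fin 2) : (pathGraph 2).dist i k = if i = k then 0 else 1 := by
  split_ifs with h
  · simp [h]
  · rw [SimpleGraph.dist_eq_one_iff_adj, pathGraph_two_eq_top]
    exact h

lemma isEccentric_boxProd_pathGraph_two {V : Type*} [Fintype V] {G : SimpleGraph V}
    (hG : G.Connected) {x y : V × Fin 2} :
    IsEccentric (G □ pathGraph 2) x y ↔ IsEccentric G x.1 y.1 ∧ x.2 ≠ y.2 := by
  have hP : (pathGraph 2).Connected := pathGraph_connected 1
  simp only [isEccentric_iff, dist_boxProd_of_connected hG hP, dist_pathGraph_two]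
  constructor
  · intro h
    have hne : x.2 ≠ y.2 := by
      intro he
      have := h (y.1, x.2 + 1)
      simp [he] at this
    refine ⟨fun w => ?_, hne⟩
    have := h (w, y.2)
    simpa using this
  · rintro ⟨h, hne⟩ w
    have := h w.1
    rw [if_neg hne]
    split_ifs <;> omega

lemma eccGraph_boxProd_pathGraph_two_adj {V : Type*} [Fintype V] [Nontrivial V]
    {G : SimpleGraph V} (hG : G.Connected) {x y : V × Fin 2} :
    (eccGraph (G □ pathGraph 2)).Adj x y ↔ (eccGraph G).Adj x.1 y.1 ∧ x.2 ≠ y.2 := by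
  simp only [eccGraph, fromRel_adj, isEccentric_boxProd_pathGraph_two hG]
  have h₁ (h : IsEccentric G x.1 y.1) := h.ne hG
  have h₂ (h : IsEccentric G y.1 x.1) := h.ne hG
  have h₃ : x.2 ≠ y.2 → x ≠ y := fun h e => h (e ▸ rfl)
  grind

/-- `H` has no cycle of length four, stated in terms of vertices. -/
def QuadFree {V : Type*} (H : SimpleGraph V) : Prop :=
  ∀ ⦃a b c d⦄, H.Adj a b → H.Adj b c → H.Adj c d → H.Adj d a → a = c ∨ b = d

/-- `H` has a closed walk of length six whose vertices in even position are distinct, and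
likewise those in odd position. Both six-cycles and doubly traversed triangles qualify. -/
def HasAlternatingHexagon {V : Type*} (H : SimpleGraph V) : Prop :=
  ∃ a b c d e f, H.Adj a b ∧ H.Adj b c ∧ H.Adj c d ∧ H.Adj d e ∧ H.Adj e f ∧ H.Adj f a ∧
    a ≠ c ∧ a ≠ e ∧ c ≠ e ∧ b ≠ d ∧ b ≠ f ∧ d ≠ f

lemma quadFree_of_no_cycle {V : Type*} {H : SimpleGraph V}
    (h : ¬ ∃ (v : V) (c : H.Walk v v), c.IsCycle ∧ c.length = 4) : QuadFree H := by
  intro a b c d hab hbc hcd hda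
  by_contra! hne
  refine h ⟨a, .cons hab (.cons hbc (.cons hcd (.cons hda .nil))), ?_, rfl⟩
  have := hab.ne
  have := hbc.ne
  have := hcd.ne
  have := hda.ne
  simp [Walk.isCycle_def, Walk.isTrail_def]
  grind

lemma QuadFree.length_ne_four {V : Type*} {H : SimpleGraph V} (h : QuadFree H) {v : V}
    {w : H.Walk v v} (hw : w.IsCycle) : w.length ≠ 4 := by
  intro hl
  match w, hw, hl with
  | .cons hab (.cons hbc (.cons hcd (.cons hda .nil))), hw, _ =>
    have := hw.support_nodup
    have := h hab hbc hcd hda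
    simp_all

lemma hasAlternatingHexagon_of_egirth_eq_three {V : Type*} {H : SimpleGraph V}
    (h : H.egirth = 3) : HasAlternatingHexagon H := by
  have hcyc : ¬ H.IsAcyclic := fun hac => by simp [egirth_eq_top.2 hac] at h
  obtain ⟨v, w, -, hw⟩ := exists_egirth_eq_length.2 hcyc
  have hl : w.length = 3 := by exact_mod_cast hw.symm.trans h
  match w, hl with
  | .cons (v := b) hab (.cons (v := c) hbc (.cons hca .nil)), _ =>
    exact ⟨v, b, c, v, b, c, hab, hbc, hca, hab, hbc, hca, hca.ne', hab.ne, hbc.ne',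
      hab.ne', hbc.ne, hca.ne'⟩

lemma six_le_egirth {V : Type*} {H : SimpleGraph V} (C : H.Coloring Bool) (h : QuadFree H) :
    6 ≤ H.egirth := by
  refine le_egirth (n := 6).2 fun a w hw => ?_
  have h₃ := hw.three_le_length
  have h₄ := h.length_ne_four hw
  have heven : Even w.length := (C.even_length_iff_congr w).2 Iff.rfl
  have : 6 ≤ w.length := by
    obtain ⟨k, hk⟩ := heven
    omega
  exact_mod_cast this

lemma HasAlternatingHexagon.egirth_le_six {V : Type*} {H : SimpleGraph V} (C : H.Coloring Bool)
    (h : HasAlternatingHexagon H) : H.egirth ≤ 6 := by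
  obtain ⟨a, b, c, d, e, f, hab, hbc, hcd, hde, hef, hfa, hne⟩ := h
  let w : H.Walk a a :=
    .cons hab (.cons hbc (.cons hcd (.cons hde (.cons hef (.cons hfa .nil)))))
  have hw : w.IsCycle := by
    have hC {x y : V} (h : H.Adj x y) : C y = !C x := Bool.eq_not.2 (C.valid h).symm
    have h₁ := hC hab
    have h₂ := hC hbc
    have h₃ := hC hcd
    have h₄ := hC hde
    have h₅ := hC hef
    have had : a ≠ d := fun h => by simp [← h, h₁, h₂] at h₃
    have hbe : b ≠ e := fun h => by simp [← h, h₂, h₃] at h₄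
    have hcf : c ≠ f := fun h => by simp [← h, h₃, h₄] at h₅
    have := hab.ne
    have := hbc.ne
    have := hcd.ne
    have := hde.ne
    have := hef.ne
    have := hfa.ne
    simp [w, Walk.isCycle_def, Walk.isTrail_def]
    grind
  exact egirth_le_length hw

section BoxProd

variable {V : Type*} [Fintype V] [Nontrivial V] {G : SimpleGraph V}

/-- The coloring of the eccentric graph of `G □ P_2` by the second coordinate. -/
noncomputable def eccGraphBoxProdColoring (hG : G.Connected) :
    (eccGraph (G □ pathGraph 2)).Coloring Bool :=
  Coloring.mk (fun x => decide (x.2 = 0)) fun {x y} h => by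
    have := ((eccGraph_boxProd_pathGraph_two_adj hG).1 h).2
    grind

lemma QuadFree.boxProd_pathGraph_two (hG : G.Connected) (h : QuadFree (eccGraph G)) :
    QuadFree (eccGraph (G □ pathGraph 2)) := by
  intro a b c d hab hbc hcd hda
  rw [eccGraph_boxProd_pathGraph_two_adj hG] at hab hbc hcd hda
  have := h hab.1 hbc.1 hcd.1 hda.1
  simp only [Prod.ext_iff]
  grind

lemma HasAlternatingHexagon.boxProd_pathGraph_two (hG : G.Connected)
    (h : HasAlternatingHexagon (eccGraph G)) :
    HasAlternatingHexagon (eccGraph (G □ pathGraph 2)) := by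
  obtain ⟨a, b, c, d, e, f, h⟩ := h
  refine ⟨(a, 0), (b, 1), (c, 0), (d, 1), (e, 0), (f, 1), ?_⟩
  simpa [eccGraph_boxProd_pathGraph_two_adj hG] using h

end BoxProd

lemma iterG_connected {V : Type*} {G : SimpleGraph V} (hG : G.Connected) :
    ∀ j, (iterG G j).Connected
  | 0 => hG
  | j + 1 => (iterG_connected hG j).boxProd (pathGraph_connected 1)

lemma iterV_nontrivial (V : Type*) [Nontrivial V] : ∀ j, Nontrivial (iterV V j)
  | 0 => inferInstanceAs (Nontrivial V)
  | j + 1 =>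
    have := iterV_nontrivial V j
    inferInstanceAs (Nontrivial (iterV V j × Fin 2))

lemma eccGraph_iterG_quadFree_and_hexagon {V : Type*} [Fintype V] [Nontrivial V]
    {G : SimpleGraph V} (hG : G.Connected) (h₄ : QuadFree (eccGraph G))
    (h₆ : HasAlternatingHexagon (eccGraph G)) (j : ℕ) :
    QuadFree (eccGraph (iterG G j)) ∧ HasAlternatingHexagon (eccGraph (iterG G j)) := by
  induction j with
  | zero => exact ⟨h₄, h₆⟩
  | succ j ih =>
    have := iterV_nontrivial V j
    have hc := iterG_connected hG j
    exact ⟨ih.1.boxProd_pathGraph_two hc, ih.2.boxProd_pathGraph_two hc⟩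

/-- If `E(T)` has girth 3 and no 4-cycle, then for every `j ≥ 1` the eccentric graph of
`G_j = T □ P_2 □ ⋯ □ P_2` (`j` copies of `P_2`) has girth 6. -/
theorem stmt_10 {V : Type*} [Fintype V] (T : SimpleGraph V) (hT : T.IsTree)
    (h3 : (eccGraph T).egirth = 3)
    (hno4 : ¬ ∃ (v : V) (c : (eccGraph T).Walk v v), c.IsCycle ∧ c.length = 4) :
    ∀ j : ℕ, 1 ≤ j → (eccGraph (iterG T j)).egirth = 6 := by
  intro j hj
  obtain ⟨j, rfl⟩ := Nat.exists_eq_add_of_le' hj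
  have h₆ := hasAlternatingHexagon_of_egirth_eq_three h3
  have : Nontrivial V := by
    obtain ⟨a, b, -, -, -, -, hab, -⟩ := h₆
    exact ⟨a, b, hab.ne⟩
  have := iterV_nontrivial V j
  have h := eccGraph_iterG_quadFree_and_hexagon hT.connected (quadFree_of_no_cycle hno4) h₆ (j + 1)
  have C : (eccGraph (iterG T (j + 1))).Coloring Bool :=
    eccGraphBoxProdColoring (iterG_connected hT.connected j)
  exact le_antisymm (h.2.egirth_le_six C) (six_le_egirth C h.1)
end

section
/- Let n ≥ 3 and m ≥ 3 both be odd. Then the girth of the eccentric graph E(C_n □ C_m) of the Cartesian product of the cycle graphs C_n and C_m equals 3 if n = 3 and m = 3, and equals 4 otherwise. -/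
open SimpleGraph

namespace SimpleGraph

theorem egirth_le_three_of_adj {V : Type*} {G : SimpleGraph V} {a b c : V}
    (hab : G.Adj a b) (hbc : G.Adj b c) (hca : G.Adj c a) : G.egirth ≤ 3 := by
  have hw : (Walk.cons hab (.cons hbc (.cons hca .nil))).IsCycle := by
    have h₁ := hab.ne
    have h₂ := hbc.ne
    have h₃ := hca.ne
    rw [Walk.isCycle_def, Walk.isTrail_def]
    simp
    grind
  simpa using egirth_le_length hw

theorem egirth_le_four_of_adj {V : Type*} {G : SimpleGraph V} {a b c d : V}
    (hab : G.Adj a b) (hbc : G.Adj b c) (hcd : G.Adj c d) (hda : G.Adj d a)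
    (hac : a ≠ c) (hbd : b ≠ d) : G.egirth ≤ 4 := by
  have hw : (Walk.cons hab (.cons hbc (.cons hcd (.cons hda .nil)))).IsCycle := by
    have h₁ := hab.ne
    have h₂ := hbc.ne
    have h₃ := hcd.ne
    have h₄ := hda.ne
    rw [Walk.isCycle_def, Walk.isTrail_def]
    simp
    grind
  simpa using egirth_le_length hw

theorem four_le_egirth_of_forall_not_adj {V : Type*} {G : SimpleGraph V}
    (h : ∀ a b c, G.Adj a b → G.Adj b c → ¬ G.Adj c a) : 4 ≤ G.egirth := by
  rw [le_egirth]
  intro a w hw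
  have h3 := hw.three_le_length
  have hne : w.length ≠ 3 := by
    intro h3
    match w, h3 with
    | .cons hab (.cons hbc (.cons hca .nil)), _ => exact h _ _ _ hab hbc hca
  exact_mod_cast (by omega : 4 ≤ w.length)

theorem cycleGraph_adj_iff_val {n : ℕ} (hn : 3 ≤ n) {u v : Fin n} :
    (cycleGraph n).Adj u v ↔ u.val + 1 = v ∨ v.val + 1 = u ∨
      (u.val = 0 ∧ v.val + 1 = n) ∨ (v.val = 0 ∧ u.val + 1 = n) := by
  have hu := u.isLt
  have hv := v.isLt
  rw [cycleGraph_adj', Fin.val_sub, Fin.val_sub]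
  rcases le_or_gt u.val v.val with h | h
  · rcases h.eq_or_lt with h | h
    · rw [show n - v.val + u = n by omega, show n - u.val + v = n by omega, Nat.mod_self]
      omega
    · rw [Nat.mod_eq_of_lt (show n - v.val + u < n by omega),
        show n - u.val + v = (v - u) + n by omega, Nat.add_mod_right,
        Nat.mod_eq_of_lt (by omega)]
      omega
  · rw [Nat.mod_eq_of_lt (show n - u.val + v < n by omega),
      show n - v.val + u = (u - v) + n by omega, Nat.add_mod_right,
      Nat.mod_eq_of_lt (by omega)]
    omega

theorem cycleGraph_dist_le_sub {n : ℕ} (hn : 3 ≤ n) (d : ℕ) {u v : Fin n}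
    (h : u.val + d = v) : (cycleGraph n).dist u v ≤ d := by
  induction d generalizing v with
  | zero =>
    obtain rfl : u = v := Fin.ext (by omega)
    simp
  | succ d ih =>
    have hd := ih (v := ⟨u + d, by omega⟩) rfl
    have hadj : (cycleGraph n).Adj ⟨u + d, by omega⟩ v :=
      (cycleGraph_adj_iff_val hn).2 (Or.inl (by simp; omega))
    have : Nonempty (Fin n) := ⟨u⟩
    have ht := (Connected.mk (cycleGraph_preconnected (n := n))).dist_triangle (u := u) (v := ⟨u + d, by omega⟩)
      (w := v)
    rw [dist_eq_one_iff_adj.2 hadj] at ht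
    omega

theorem cycleGraph_le_length {n : ℕ} (hn : 3 ≤ n) {u v : Fin n} (w : (cycleGraph n).Walk u v) :
    min ((u - v : ℕ) + (v - u : ℕ)) (n - ((u - v : ℕ) + (v - u : ℕ))) ≤ w.length := by
  induction w with
  | nil => simp
  | @cons a b c h p ih =>
    rw [cycleGraph_adj_iff_val hn] at h
    rw [Walk.length_cons]
    omega

theorem cycleGraph_dist {n : ℕ} (hn : 3 ≤ n) (u v : Fin n) :
    (cycleGraph n).dist u v =
      min ((u - v : ℕ) + (v - u : ℕ)) (n - ((u - v : ℕ) + (v - u : ℕ))) := by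
  have hconn : (cycleGraph n).Connected :=
    have : Nonempty (Fin n) := ⟨u⟩
    ⟨cycleGraph_preconnected⟩
  refine le_antisymm ?_ ?_
  · wlog huv : u ≤ v generalizing u v
    · rw [dist_comm, Nat.add_comm (u - v : ℕ)]
      exact this v u (le_of_not_ge huv)
    have huv' : u.val ≤ v := huv
    have h₁ := cycleGraph_dist_le_sub hn (v - u : ℕ) (u := u) (v := v) (by omega)
    let a : Fin n := ⟨0, by omega⟩
    let b : Fin n := ⟨n - 1, by omega⟩
    have h₂ := cycleGraph_dist_le_sub hn u.val (u := a) (v := u) (by simp [a])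
    have h₃ := cycleGraph_dist_le_sub hn (n - 1 - v) (u := v) (v := b) (by simp only [b]; omega)
    have h₄ : (cycleGraph n).dist a b = 1 := dist_eq_one_iff_adj.2
      ((cycleGraph_adj_iff_val hn).2 (.inr (.inr (.inl ⟨rfl, by simp only [b]; omega⟩))))
    have h₅ := hconn.dist_triangle (u := u) (v := a) (w := v)
    have h₆ := hconn.dist_triangle (u := a) (v := b) (w := v)
    rw [dist_comm (u := u) (v := a)] at h₅
    rw [dist_comm (u := b) (v := v)] at h₆
    omega
  · obtain ⟨w, hw⟩ := (hconn u v).exists_walk_length_eq_dist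
    exact hw ▸ cycleGraph_le_length hn w

theorem Preconnected.dist_boxProd {V W : Type*} {G : SimpleGraph V} {H : SimpleGraph W}
    (hG : G.Preconnected) (hH : H.Preconnected) (x y : V × W) :
    (G □ H).dist x y = G.dist x.1 y.1 + H.dist x.2 y.2 := by
  have h := edist_boxProd (G := G) (H := H) x y
  rw [← (hG.boxProd hH x y).coe_dist_eq_edist, ← (hG _ _).coe_dist_eq_edist,
    ← (hH _ _).coe_dist_eq_edist] at h
  exact_mod_cast h

theorem cycleGraph_odd_dist_eq_iff {k : ℕ} (hk : 1 ≤ k) (u v : Fin (2 * k + 1)) :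
    (cycleGraph (2 * k + 1)).dist u v = k ↔
      (u + k = v.val ∨ u + k + 1 = v.val ∨ v + k = u.val ∨ v + k + 1 = u.val) := by
  rw [cycleGraph_dist (by omega)]
  omega

theorem cycleGraph_odd_dist_le {k : ℕ} (hk : 1 ≤ k) (u v : Fin (2 * k + 1)) :
    (cycleGraph (2 * k + 1)).dist u v ≤ k := by
  rw [cycleGraph_dist (by omega)]
  omega

theorem cycleGraph_odd_exists_dist_eq {k : ℕ} (hk : 1 ≤ k) (u : Fin (2 * k + 1)) :
    ∃ v, (cycleGraph (2 * k + 1)).dist u v = k := by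
  by_cases h : u.val ≤ k
  · exact ⟨⟨u + k, by omega⟩, (cycleGraph_odd_dist_eq_iff hk _ _).2 (by simp)⟩
  · exact ⟨⟨u - k, by omega⟩, (cycleGraph_odd_dist_eq_iff hk _ _).2 (by simp only; omega)⟩

end SimpleGraph

theorem ecc_boxProd_cycleGraph_odd {k l : ℕ} (hk : 1 ≤ k) (hl : 1 ≤ l)
    (x : Fin (2 * k + 1) × Fin (2 * l + 1)) :
    ecc ((cycleGraph (2 * k + 1)).boxProd (cycleGraph (2 * l + 1))) x = k + l := by
  have hdist := Preconnected.dist_boxProd cycleGraph_preconnected (cycleGraph_preconnected (n := 2 * l + 1))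
    (G := cycleGraph (2 * k + 1)) x
  refine le_antisymm (Finset.sup_le fun y _ => ?_) ?_
  · rw [hdist]
    exact add_le_add (cycleGraph_odd_dist_le hk _ _) (cycleGraph_odd_dist_le hl _ _)
  · obtain ⟨a, ha⟩ := cycleGraph_odd_exists_dist_eq hk x.1
    obtain ⟨b, hb⟩ := cycleGraph_odd_exists_dist_eq hl x.2
    have h := hdist (a, b)
    rw [ha, hb] at h
    rw [← h]
    exact Finset.le_sup (f := fun y => ((cycleGraph (2 * k + 1)).boxProd
      (cycleGraph (2 * l + 1))).dist x y) (Finset.mem_univ (a, b))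

theorem isEccentric_boxProd_cycleGraph_odd_iff {k l : ℕ} (hk : 1 ≤ k) (hl : 1 ≤ l)
    (x y : Fin (2 * k + 1) × Fin (2 * l + 1)) :
    IsEccentric ((cycleGraph (2 * k + 1)).boxProd (cycleGraph (2 * l + 1))) x y ↔
      (cycleGraph (2 * k + 1)).dist x.1 y.1 = k ∧ (cycleGraph (2 * l + 1)).dist x.2 y.2 = l := by
  rw [IsEccentric, ecc_boxProd_cycleGraph_odd hk hl,
    Preconnected.dist_boxProd cycleGraph_preconnected cycleGraph_preconnected]
  have h₁ := cycleGraph_odd_dist_le hk x.1 y.1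
  have h₂ := cycleGraph_odd_dist_le hl x.2 y.2
  omega

theorem eccGraph_boxProd_cycleGraph_odd_adj_iff {k l : ℕ} (hk : 1 ≤ k) (hl : 1 ≤ l)
    (x y : Fin (2 * k + 1) × Fin (2 * l + 1)) :
    (eccGraph ((cycleGraph (2 * k + 1)).boxProd (cycleGraph (2 * l + 1)))).Adj x y ↔
      (x.1 + k = y.1.val ∨ x.1 + k + 1 = y.1.val ∨ y.1 + k = x.1.val ∨ y.1 + k + 1 = x.1.val) ∧
      (x.2 + l = y.2.val ∨ x.2 + l + 1 = y.2.val ∨ y.2 + l = x.2.val ∨ y.2 + l + 1 = x.2.val) := by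
  rw [eccGraph, fromRel_adj, isEccentric_boxProd_cycleGraph_odd_iff hk hl,
    isEccentric_boxProd_cycleGraph_odd_iff hk hl, dist_comm (u := y.1), dist_comm (u := y.2),
    or_self, ← cycleGraph_odd_dist_eq_iff hk, ← cycleGraph_odd_dist_eq_iff hl, and_iff_right_iff_imp]
  rintro ⟨h, -⟩ rfl
  rw [dist_self] at h
  omega

/-- For odd `n, m ≥ 3`, the eccentric graph of `C_n □ C_m` has girth 3 if `n = m = 3`,
and girth 4 otherwise. -/
theorem stmt_16 (n m : ℕ) (hn3 : 3 ≤ n) (hnodd : Odd n) (hm3 : 3 ≤ m) (hmodd : Odd m) :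
    (eccGraph ((cycleGraph n).boxProd (cycleGraph m))).egirth =
      if n = 3 ∧ m = 3 then 3 else 4 := by
  obtain ⟨k, rfl⟩ := hnodd
  obtain ⟨l, rfl⟩ := hmodd
  have hk : 1 ≤ k := by omega
  have hl : 1 ≤ l := by omega
  have hadj := eccGraph_boxProd_cycleGraph_odd_adj_iff hk hl
  split_ifs with h
  · refine le_antisymm (egirth_le_three_of_adj (a := (⟨0, by omega⟩, ⟨0, by omega⟩))
      (b := (⟨1, by omega⟩, ⟨1, by omega⟩)) (c := (⟨2, by omega⟩, ⟨2, by omega⟩))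
      ?_ ?_ ?_) three_le_egirth
    all_goals
      rw [hadj]
      simp only
      omega
  · refine le_antisymm (egirth_le_four_of_adj (a := (⟨0, by omega⟩, ⟨0, by omega⟩))
      (b := (⟨k, by omega⟩, ⟨l, by omega⟩)) (c := (⟨0, by omega⟩, ⟨2 * l, by omega⟩))
      (d := (⟨k + 1, by omega⟩, ⟨l, by omega⟩)) ?_ ?_ ?_ ?_ ?_ ?_)
      (four_le_egirth_of_forall_not_adj fun a b c hab hbc hca => ?_)
    · rw [hadj]; simp
    · rw [hadj]; simp only; omega
    · rw [hadj]; simp only; omega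
    · rw [hadj]; simp
    · simp; omega
    · simp
    · rw [hadj] at hab hbc hca
      have hk1 : k = 1 := by
        have := hab.1
        have := hbc.1
        have := hca.1
        omega
      have hl1 : l = 1 := by
        have := hab.2
        have := hbc.2
        have := hca.2
        omega
      omega
end
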